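/- arXiv:2405.07785 — 5 statements merged into one kernel-verified Lean document; each statement's English description precedes it below -/
import Mathlib

section
/- Let g, r : ℕ → (0,∞) satisfy g_n → ∞ and c·g_n ≤ r_n ≤ e·g_n for all n, for some c ∈ (0,e), and fix ρ ∈ (0,1). Let X̃ ~ Gam(1/2, 2g_n), let X̄ := X̃|_{S_n} be its truncation to S_n := [ g_n^{−(1+3ρ)}, g_n^{1+ρ} ], and let X := ⌈X̄⌉. Let Z satisfy Z | X = x ~ Poisson((r_n/g_n)·x) and let Z̄ satisfy Z̄ | X̄ = u ~ Poisson((r_n/g_n)·u). Then for every ε > 0 there exists n₀ such that for all n ≥ n₀, I(X;Z) ≥ I(X̄;Z̄) − Ψ(r_n/g_n) − ε. -/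
open Filter Set MeasureTheory ProbabilityTheory

/-- The Poisson pmf with (real) mean `lam`. -/
noncomputable def poissonPMFr (lam : ℝ) (z : ℕ) : ℝ :=
  Real.exp (-lam) * lam ^ z / (z.factorial : ℝ)

/-- Output marginal of the Poisson channel `V | U = u ~ Poi(a u)` with input law `μ`. -/
noncomputable def poissonMarg (μ : Measure ℝ) (a : ℝ) (z : ℕ) : ℝ :=
  ∫ u, poissonPMFr (a * u) z ∂μ

/-- Mutual information (in nats) of the Poisson channel `V | U = u ~ Poi(a u)`
with input law `μ` (equal to the KL divergence between the joint law and the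
product of marginals). -/
noncomputable def poissonMI (μ : Measure ℝ) (a : ℝ) : ℝ :=
  ∫ u, (∑' z : ℕ, poissonPMFr (a * u) z *
      Real.log (poissonPMFr (a * u) z / poissonMarg μ a z)) ∂μ

/-- The law of `Gam(1/2, 2g)` (shape 1/2, scale `2g`, i.e. rate `1/(2g)`). -/
noncomputable def gammaHalf (g : ℝ) : Measure ℝ :=
  gammaMeasure (1 / 2) (1 / (2 * g))

/-- Binary entropy (natural logarithm). -/
noncomputable def binEnt (p : ℝ) : ℝ := -p * Real.log p - (1 - p) * Real.log (1 - p)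

/-- `Ψ(μ) = (μ+1) h_b(1/(μ+1))`. -/
noncomputable def Psi (μ : ℝ) : ℝ := (μ + 1) * binEnt (1 / (μ + 1))

lemma pois_nonneg {x : ℝ} (hx : 0 ≤ x) (z : ℕ) : 0 ≤ poissonPMFr x z := by
  unfold poissonPMFr; positivity

lemma pois_pos {x : ℝ} (hx : 0 < x) (z : ℕ) : 0 < poissonPMFr x z := by
  unfold poissonPMFr; positivity

lemma pois_le {x b : ℝ} (hx : 0 ≤ x) (hb : x ≤ b) (z : ℕ) :
    poissonPMFr x z ≤ b ^ z / (z.factorial : ℝ) := by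
  unfold poissonPMFr
  have h1 : Real.exp (-x) ≤ 1 := by simpa using hx
  have h2 : x ^ z ≤ b ^ z := by gcongr
  have h3 : 0 ≤ x ^ z := by positivity
  gcongr
  nlinarith

lemma le_pois {x d b : ℝ} (hd : 0 < d) (hx : d ≤ x) (hb : x ≤ b) (z : ℕ) :
    Real.exp (-b) * d ^ z / (z.factorial : ℝ) ≤ poissonPMFr x z := by
  unfold poissonPMFr
  gcongr

lemma hasSum_powfact (x : ℝ) : HasSum (fun z : ℕ => x ^ z / (z.factorial : ℝ)) (Real.exp x) := by
  rw [Real.exp_eq_exp_ℝ]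
  exact NormedSpace.expSeries_div_hasSum_exp x

lemma hasSum_powfact_mul (x : ℝ) :
    HasSum (fun z : ℕ => x ^ z / (z.factorial : ℝ) * z) (x * Real.exp x) := by
  rw [← hasSum_nat_add_iff' 1]
  simp only [Finset.range_one, Finset.sum_singleton, Nat.cast_zero, mul_zero, sub_zero]
  convert! (hasSum_powfact x).mul_left x using 2 with z
  rw [Nat.factorial_succ]
  push_cast
  have h1 : (z.factorial : ℝ) ≠ 0 := by positivity
  have h2 : (z : ℝ) + 1 ≠ 0 := by positivity
  field_simp
  ring

lemma hasSum_pois (x : ℝ) : HasSum (poissonPMFr x) 1 := by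
  have h := (hasSum_powfact x).mul_left (Real.exp (-x))
  rw [← Real.exp_add, neg_add_cancel, Real.exp_zero] at h
  convert! h using 2 with z
  unfold poissonPMFr; ring

lemma hasSum_pois_mul (x : ℝ) : HasSum (fun z : ℕ => poissonPMFr x z * z) x := by
  have h := (hasSum_powfact_mul x).mul_left (Real.exp (-x))
  rw [mul_left_comm, ← Real.exp_add, neg_add_cancel, Real.exp_zero, mul_one] at h
  convert! h using 2 with z
  unfold poissonPMFr; ring

lemma pois_conv (x t : ℝ) (z : ℕ) :
    ∑ p ∈ Finset.HasAntidiagonal.antidiagonal z, poissonPMFr x p.1 * poissonPMFr t p.2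
      = poissonPMFr (x + t) z := by
  unfold poissonPMFr
  rw [(Commute.all x t).add_pow', Finset.mul_sum, Finset.sum_div]
  refine Finset.sum_congr rfl fun p hp => ?_
  rw [Finset.HasAntidiagonal.mem_antidiagonal] at hp
  subst hp
  have h : ((p.1 + p.2).choose p.1 : ℝ) * p.1.factorial * p.2.factorial
      = ((p.1 + p.2).factorial : ℝ) := by
    rw [Nat.choose_symm_add]
    exact_mod_cast Nat.add_choose_mul_factorial_mul_factorial p.1 p.2
  have e : Real.exp (-(x + t)) = Real.exp (-x) * Real.exp (-t) := by
    rw [← Real.exp_add]; congr 1; ring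
  rw [e, ← h, nsmul_eq_mul]
  have h0 : ((p.1 + p.2).choose p.1 : ℝ) ≠ 0 := by
    exact_mod_cast (Nat.choose_pos (Nat.le_add_right _ _)).ne'
  have h1 : (p.1.factorial : ℝ) ≠ 0 := by positivity
  have h2 : (p.2.factorial : ℝ) ≠ 0 := by positivity
  field_simp

lemma pois_mul_le {x t : ℝ} (hx : 0 ≤ x) (ht : 0 ≤ t) (y k : ℕ) :
    poissonPMFr x y * poissonPMFr t k ≤ poissonPMFr (x + t) (y + k) := by
  rw [← pois_conv]
  exact Finset.single_le_sum (f := fun p : ℕ × ℕ => poissonPMFr x p.1 * poissonPMFr t p.2)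
    (fun p _ => mul_nonneg (pois_nonneg hx _) (pois_nonneg ht _))
    (Finset.HasAntidiagonal.mem_antidiagonal.2 rfl : (y, k) ∈ Finset.HasAntidiagonal.antidiagonal (y + k))

lemma pois_summable_lin (x A B : ℝ) :
    Summable (fun z : ℕ => poissonPMFr x z * (A + B * z)) := by
  have := ((hasSum_pois x).summable.mul_left A).add ((hasSum_pois_mul x).summable.mul_left B)
  refine this.congr fun z => ?_
  ring

lemma pois_double {x t A B : ℝ} (hx : 0 ≤ x) (ht : 0 ≤ t) (h : ℕ → ℝ)
    (hh : ∀ z : ℕ, |h z| ≤ A + B * z) :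
    HasSum (fun p : ℕ × ℕ => poissonPMFr x p.1 * poissonPMFr t p.2 * h (p.1 + p.2))
      (∑' z, poissonPMFr (x + t) z * h z) := by
  have hs : Summable (fun p : ℕ × ℕ => poissonPMFr x p.1 * poissonPMFr t p.2 * h (p.1 + p.2)) := by
    have s1 : Summable (fun p : ℕ × ℕ =>
        (poissonPMFr x p.1 * (|A| + |B| * p.1)) * poissonPMFr t p.2) :=
      (pois_summable_lin x |A| |B|).mul_of_nonneg (hasSum_pois t).summable
        (fun z => mul_nonneg (pois_nonneg hx z) (by positivity)) (fun z => pois_nonneg ht z)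
    have s2 : Summable (fun p : ℕ × ℕ =>
        poissonPMFr x p.1 * (poissonPMFr t p.2 * (0 + |B| * p.2))) :=
      (hasSum_pois x).summable.mul_of_nonneg (pois_summable_lin t 0 |B|)
        (fun z => pois_nonneg hx z) (fun z => mul_nonneg (pois_nonneg ht z) (by positivity))
    refine Summable.of_norm_bounded (s1.add s2) fun p => ?_
    have p1 := pois_nonneg hx p.1
    have p2 := pois_nonneg ht p.2
    rw [Real.norm_eq_abs, abs_mul, abs_of_nonneg (mul_nonneg p1 p2)]
    have := hh (p.1 + p.2)
    push_cast at this
    have h3 : A + B * ((p.1 : ℝ) + p.2) ≤ |A| + |B| * ((p.1 : ℝ) + p.2) := by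
      gcongr <;> exact le_abs_self _
    calc _ ≤ poissonPMFr x p.1 * poissonPMFr t p.2 * (|A| + |B| * ((p.1 : ℝ) + p.2)) :=
          mul_le_mul_of_nonneg_left (this.trans h3) (mul_nonneg p1 p2)
      _ = _ := by ring
  have h1 := (Finset.HasAntidiagonal.sigmaAntidiagonalEquivProd (A := ℕ)).summable_iff.2 hs
  have key : ∑' p : ℕ × ℕ, poissonPMFr x p.1 * poissonPMFr t p.2 * h (p.1 + p.2)
      = ∑' z, poissonPMFr (x + t) z * h z := by
    rw [← (Finset.HasAntidiagonal.sigmaAntidiagonalEquivProd (A := ℕ)).tsum_eq]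
    refine (Summable.tsum_sigma' (fun z => (hasSum_fintype _).summable) h1).trans ?_
    refine tsum_congr fun z => ?_
    rw [tsum_fintype, ← pois_conv, Finset.sum_mul]
    rw [← Finset.sum_coe_sort (Finset.HasAntidiagonal.antidiagonal z)
      (fun p : ℕ × ℕ => poissonPMFr x p.1 * poissonPMFr t p.2 * h z)]
    refine Finset.sum_congr rfl fun p _ => ?_
    have := Finset.HasAntidiagonal.mem_antidiagonal.1 p.2
    simp [this]
  rw [← key]
  exact hs.hasSum

lemma hasSum_prod_mul {f h : ℕ → ℝ} {s t : ℝ} (hf : HasSum f s) (hh : HasSum h t) :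
    HasSum (fun p : ℕ × ℕ => f p.1 * h p.2) (s * t) :=
  HasSum.mul hf hh (summable_mul_of_summable_norm (f := f) (g := h) hf.summable.norm
    hh.summable.norm)

lemma Psi_eq {a : ℝ} (ha : 0 < a) :
    Psi a = Real.log (1 + a) + a * Real.log ((1 + a) / a) := by
  unfold Psi binEnt
  have h : 1 - 1 / (a + 1) = a / (a + 1) := by field_simp; ring
  rw [h, Real.log_div (by positivity) (by positivity), Real.log_div (by positivity) (by positivity),
    Real.log_div (by positivity) (by positivity), Real.log_one, add_comm 1 a]
  field_simp
  ring

lemma Psi_nonneg {a : ℝ} (ha : 0 < a) : 0 ≤ Psi a := by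
  rw [Psi_eq ha]
  have h1 : 0 ≤ Real.log (1 + a) := Real.log_nonneg (by linarith)
  have h2 : 0 ≤ Real.log ((1 + a) / a) := Real.log_nonneg (by rw [le_div_iff₀ ha]; linarith)
  positivity

/-- the geometric pmf with mean `a` -/
noncomputable def geo (a : ℝ) (k : ℕ) : ℝ := (1 / (1 + a)) * (a / (1 + a)) ^ k

lemma geo_pos {a : ℝ} (ha : 0 < a) (k : ℕ) : 0 < geo a k := by unfold geo; positivity

lemma geo_hasSum {a : ℝ} (ha : 0 < a) : HasSum (geo a) 1 := by
  have h := (hasSum_geometric_of_lt_one (r := a / (1 + a)) (by positivity)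
    (by rw [div_lt_one (by positivity)]; linarith)).mul_left (1 / (1 + a))
  convert! h using 1
  have h2 : 1 - a / (1 + a) = 1 / (1 + a) := by field_simp; ring
  rw [h2]
  field_simp

lemma geo_le_one {a : ℝ} (ha : 0 < a) (k : ℕ) : geo a k ≤ 1 :=
  le_hasSum (geo_hasSum ha) k fun j _ => (geo_pos ha j).le

lemma log_geo {a : ℝ} (ha : 0 < a) (k : ℕ) :
    -Real.log (geo a k) = Real.log (1 + a) + Real.log ((1 + a) / a) * k := by
  unfold geo
  rw [Real.log_mul (by positivity) (by positivity), Real.log_pow,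
    Real.log_div (by positivity) (by positivity), Real.log_div (by positivity) (by positivity),
    Real.log_div (by positivity) (by positivity), Real.log_one]
  ring

/-- dominated series of functions -/
lemma dom_series {ι : Type*} [Countable ι] (μ : Measure ℝ) [IsProbabilityMeasure μ]
    (f : ι → ℝ → ℝ) (b : ι → ℝ) (hm : ∀ i, Measurable (f i)) (hb : Summable b)
    (h : ∀ᵐ u ∂μ, ∀ i, |f i u| ≤ b i) :
    (∀ i, Integrable (f i) μ) ∧ Integrable (fun u => ∑' i, f i u) μ ∧
      HasSum (fun i => ∫ u, f i u ∂μ) (∫ u, ∑' i, f i u ∂μ) := by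
  refine ⟨fun i => ?_, ?_, ?_⟩
  · refine Integrable.of_bound (hm i).aestronglyMeasurable (b i) ?_
    filter_upwards [h] with u hu using hu i
  · refine Integrable.of_bound (Measurable.tsum hm).aestronglyMeasurable (∑' i, b i) ?_
    filter_upwards [h] with u hu
    exact tsum_of_norm_bounded hb.hasSum hu
  · refine hasSum_integral_of_dominated_convergence (fun i _ => b i)
      (fun i => (hm i).aestronglyMeasurable) (fun i => ?_) (ae_of_all _ fun _ => hb)
      (integrable_const _) ?_
    · filter_upwards [h] with u hu using hu i
    · filter_upwards [h] with u hu
      exact (Summable.of_norm_bounded hb hu).hasSum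

lemma meas_pois (a : ℝ) (z : ℕ) : Measurable (fun u : ℝ => poissonPMFr (a * u) z) := by
  unfold poissonPMFr; fun_prop

lemma marg_bounds (μ : Measure ℝ) [IsProbabilityMeasure μ] {a d b : ℝ} (hd : 0 < d)
    (h : ∀ᵐ u ∂μ, d ≤ a * u ∧ a * u ≤ b) (z : ℕ) :
    Real.exp (-b) * d ^ z / (z.factorial : ℝ) ≤ poissonMarg μ a z ∧
      poissonMarg μ a z ≤ b ^ z / (z.factorial : ℝ) := by
  have hi : Integrable (fun u => poissonPMFr (a * u) z) μ := by
    refine Integrable.of_bound (meas_pois a z).aestronglyMeasurable (b ^ z / (z.factorial : ℝ)) ?_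
    filter_upwards [h] with u hu
    rw [Real.norm_eq_abs, abs_of_nonneg (pois_nonneg (hd.le.trans hu.1) z)]
    exact pois_le (hd.le.trans hu.1) hu.2 z
  unfold poissonMarg
  constructor
  · have : ∫ _u, Real.exp (-b) * d ^ z / (z.factorial : ℝ) ∂μ
        = Real.exp (-b) * d ^ z / (z.factorial : ℝ) := by simp
    rw [← this]
    refine integral_mono_ae (integrable_const _) hi ?_
    filter_upwards [h] with u hu using le_pois hd hu.1 hu.2 z
  · have : ∫ _u, b ^ z / (z.factorial : ℝ) ∂μ = b ^ z / (z.factorial : ℝ) := by simp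
    rw [← this]
    refine integral_mono_ae hi (integrable_const _) ?_
    filter_upwards [h] with u hu using pois_le (hd.le.trans hu.1) hu.2 z

lemma marg_pos (μ : Measure ℝ) [IsProbabilityMeasure μ] {a d b : ℝ} (hd : 0 < d)
    (h : ∀ᵐ u ∂μ, d ≤ a * u ∧ a * u ≤ b) (z : ℕ) : 0 < poissonMarg μ a z :=
  lt_of_lt_of_le (by positivity) (marg_bounds μ hd h z).1

lemma marg_hasSum (μ : Measure ℝ) [IsProbabilityMeasure μ] {a d b : ℝ} (hd : 0 < d)
    (h : ∀ᵐ u ∂μ, d ≤ a * u ∧ a * u ≤ b) : HasSum (poissonMarg μ a) 1 := by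
  have := (dom_series μ (fun z u => poissonPMFr (a * u) z) (fun z => b ^ z / (z.factorial : ℝ))
    (meas_pois a) (hasSum_powfact b).summable (by
      filter_upwards [h] with u hu z
      rw [abs_of_nonneg (pois_nonneg (hd.le.trans hu.1) z)]
      exact pois_le (hd.le.trans hu.1) hu.2 z)).2.2
  simp only [(hasSum_pois _).tsum_eq] at this
  simp only [integral_const, probReal_univ, one_smul] at this
  exact this

lemma logratio_bound {x M d b : ℝ} {z : ℕ} (hd : 0 < d) (hx : d ≤ x) (hb : x ≤ b)
    (h1 : Real.exp (-b) * d ^ z / (z.factorial : ℝ) ≤ M) (h2 : M ≤ b ^ z / (z.factorial : ℝ)) :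
    |Real.log (poissonPMFr x z / M)| ≤ b + Real.log (b / d) * z := by
  have hb0 : 0 < b := by linarith
  have L0 : 0 < Real.exp (-b) * d ^ z / (z.factorial : ℝ) := by positivity
  have M0 : 0 < M := L0.trans_le h1
  have p1 := le_pois hd hx hb z
  have p2 := pois_le (hd.le.trans hx) hb z
  have P0 := L0.trans_le p1
  rw [Real.log_div P0.ne' M0.ne']
  have l1 := Real.log_le_log L0 h1
  have l2 := Real.log_le_log M0 h2
  have l3 := Real.log_le_log L0 p1
  have l4 := Real.log_le_log P0 p2
  have e1 : Real.log (Real.exp (-b) * d ^ z / (z.factorial : ℝ))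
      = -b + z * Real.log d - Real.log (z.factorial : ℝ) := by
    rw [Real.log_div (by positivity) (by positivity), Real.log_mul (by positivity) (by positivity),
      Real.log_exp, Real.log_pow]
  have e2 : Real.log (b ^ z / (z.factorial : ℝ)) = z * Real.log b - Real.log (z.factorial : ℝ) := by
    rw [Real.log_div (by positivity) (by positivity), Real.log_pow]
  rw [Real.log_div hb0.ne' hd.ne']
  rw [abs_le]
  constructor <;> nlinarith

lemma MI_integrable (μ : Measure ℝ) [IsProbabilityMeasure μ] {a d b : ℝ} (hd : 0 < d)
    (h : ∀ᵐ u ∂μ, d ≤ a * u ∧ a * u ≤ b) :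
    Integrable (fun u => ∑' z : ℕ, poissonPMFr (a * u) z *
      Real.log (poissonPMFr (a * u) z / poissonMarg μ a z)) μ := by
  refine (dom_series μ (fun z u => poissonPMFr (a * u) z *
      Real.log (poissonPMFr (a * u) z / poissonMarg μ a z))
    (fun z => b ^ z / (z.factorial : ℝ) * (b + Real.log (b / d) * z)) ?_ ?_ ?_).2.1
  · intro z
    have := meas_pois a z
    fun_prop
  · refine (((hasSum_powfact b).summable.mul_left b).add
      ((hasSum_powfact_mul b).summable.mul_left (Real.log (b / d)))).congr fun z => ?_
    ring
  · filter_upwards [h] with u hu z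
    have p0 := pois_nonneg (hd.le.trans hu.1) z
    have hb0 : 0 < b := by linarith [hu.1, hu.2]
    rw [abs_mul, abs_of_nonneg p0]
    have m := marg_bounds μ hd h z
    exact mul_le_mul (pois_le (hd.le.trans hu.1) hu.2 z) (logratio_bound hd hu.1 hu.2 m.1 m.2)
      (abs_nonneg _) (by positivity)

/-- pointwise inequality -/
lemma pointwise_ineq {p w q mb m s : ℝ} (hp : 0 < p) (hw : 0 ≤ w) (hq : 0 < q) (hmb : 0 < mb)
    (hm : 0 < m) (hs : 0 < s) (hpq : p * w ≤ q) :
    p * Real.log (p / mb) * w ≤ p * w * Real.log (q / m) + p * (w * -Real.log s)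
      + m * s / mb * p - p * w := by
  rcases hw.eq_or_lt with h0 | h0
  · subst h0
    have : 0 ≤ m * s / mb * p := by positivity
    simpa using this
  · have h1 := Real.log_le_sub_one_of_pos (x := m * s / (mb * w)) (by positivity)
    have h2 := Real.log_le_log (by positivity) hpq
    rw [Real.log_mul hp.ne' h0.ne'] at h2
    rw [Real.log_div (by positivity) (by positivity), Real.log_mul hm.ne' hs.ne',
      Real.log_mul hmb.ne' h0.ne'] at h1
    rw [Real.log_div hp.ne' hmb.ne', Real.log_div hq.ne' hm.ne']
    have h3 : Real.log p - Real.log mb ≤ Real.log q - Real.log m - Real.log s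
        + m * s / (mb * w) - 1 := by linarith
    have h4 := mul_le_mul_of_nonneg_left h3 (mul_pos hp h0).le
    have h5 : p * w * (m * s / (mb * w)) = m * s / mb * p := by
      field_simp
    nlinarith

set_option maxHeartbeats 1000000 in
lemma abs_main (μ : Measure ℝ) [IsProbabilityMeasure μ] {a l R : ℝ} (ha : 0 < a) (hl : 0 < l)
    (h : ∀ᵐ u ∂μ, l ≤ u ∧ u ≤ R) (φ : ℝ → ℝ) (hφ : Measurable φ)
    (hφ1 : ∀ u, 0 < u → u ≤ φ u ∧ φ u ≤ u + 1) :
    poissonMI μ a ≤ poissonMI (Measure.map φ μ) a + Psi a := by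
  have hprob : IsProbabilityMeasure (Measure.map φ μ) :=
    Measure.isProbabilityMeasure_map hφ.aemeasurable
  set μ' := Measure.map φ μ with hμ'
  set d := a * l with hdd
  set b := a * (R + 1) with hbb
  have hd : 0 < d := by positivity
  have H1 : ∀ᵐ u ∂μ, d ≤ a * u ∧ a * u ≤ b := by
    filter_upwards [h] with u hu
    exact ⟨mul_le_mul_of_nonneg_left hu.1 ha.le, mul_le_mul_of_nonneg_left (by linarith) ha.le⟩
  have H2' : ∀ᵐ u ∂μ, d ≤ a * φ u ∧ a * φ u ≤ b := by
    filter_upwards [h] with u hu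
    have := hφ1 u (by linarith)
    exact ⟨mul_le_mul_of_nonneg_left (by linarith) ha.le,
      mul_le_mul_of_nonneg_left (by linarith) ha.le⟩
  have H2 : ∀ᵐ u ∂μ', d ≤ a * u ∧ a * u ≤ b := by
    rw [hμ', ae_map_iff hφ.aemeasurable]
    · exact H2'
    · exact (measurable_const_mul a) (measurableSet_Icc (a := d) (b := b))
  clear_value d b
  set mb := poissonMarg μ a with hmb
  set m := poissonMarg μ' a with hm
  have mbpos : ∀ z, 0 < mb z := marg_pos μ hd H1
  have mpos : ∀ z, 0 < m z := marg_pos μ' hd H2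
  have hmsum : HasSum m 1 := marg_hasSum μ' hd H2
  -- the correction term
  have bsum : Summable (fun p : ℕ × ℕ => Real.exp b * ((b * b / d) ^ p.1 / (p.1.factorial : ℝ) *
      (b ^ p.2 / (p.2.factorial : ℝ)))) :=
    Summable.mul_left _ (summable_mul_of_summable_norm (hasSum_powfact (b * b / d)).summable.norm
          (hasSum_powfact b).summable.norm)
  have D := dom_series μ (fun (p : ℕ × ℕ) u => m (p.1 + p.2) * geo a p.2 / mb p.1
      * poissonPMFr (a * u) p.1)
    (fun p => Real.exp b * ((b * b / d) ^ p.1 / (p.1.factorial : ℝ) *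
      (b ^ p.2 / (p.2.factorial : ℝ)))) (fun p => (meas_pois a p.1).const_mul _) bsum
  have hD : ∀ᵐ u ∂μ, ∀ p : ℕ × ℕ, |m (p.1 + p.2) * geo a p.2 / mb p.1
      * poissonPMFr (a * u) p.1| ≤ Real.exp b * ((b * b / d) ^ p.1 / (p.1.factorial : ℝ) *
      (b ^ p.2 / (p.2.factorial : ℝ))) := by
    filter_upwards [H1] with u hu p
    obtain ⟨y, k⟩ := p
    simp only
    have hb0 : 0 < b := by linarith [hu.1, hu.2]
    have p0 := pois_nonneg (hd.le.trans hu.1) y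
    have g0 := geo_pos ha k
    have m0 := mpos (y + k)
    have mb0 := mbpos y
    rw [abs_of_nonneg (by positivity)]
    have b1 : m (y + k) ≤ b ^ (y + k) / ((y.factorial : ℝ) * k.factorial) := by
      refine (marg_bounds μ' hd H2 (y + k)).2.trans ?_
      gcongr
      exact_mod_cast Nat.le_of_dvd (Nat.factorial_pos _)
        (Nat.factorial_mul_factorial_dvd_factorial_add y k)
    have b2 := (marg_bounds μ hd H1 y).1
    have b3 := pois_le (hd.le.trans hu.1) hu.2 y
    have b4 := geo_le_one ha k
    calc m (y + k) * geo a k / mb y * poissonPMFr (a * u) y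
        ≤ b ^ (y + k) / ((y.factorial : ℝ) * k.factorial) * 1 /
          (Real.exp (-b) * d ^ y / (y.factorial : ℝ)) * (b ^ y / (y.factorial : ℝ)) := by
          gcongr
      _ = _ := by
          rw [Real.exp_neg, div_pow, mul_pow, pow_add]
          field_simp
  obtain ⟨-, DI, DS⟩ := D hD
  -- integral of the correction term
  have hcorr : ∫ u, ∑' p : ℕ × ℕ, m (p.1 + p.2) * geo a p.2 / mb p.1
      * poissonPMFr (a * u) p.1 ∂μ ≤ 1 := by
    have e : ∀ p : ℕ × ℕ, ∫ u, m (p.1 + p.2) * geo a p.2 / mb p.1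
      * poissonPMFr (a * u) p.1 ∂μ = m (p.1 + p.2) * geo a p.2 := by
      intro p
      rw [integral_const_mul]
      change _ * mb p.1 = _
      have := (mbpos p.1).ne'
      field_simp
    simp only [e] at DS
    have DS' := (Equiv.prodComm ℕ ℕ).hasSum_iff.2 DS
    have hk : ∀ k, HasSum (fun y => m (y + k) * geo a k) ((∑' y, m (y + k)) * geo a k) := fun k =>
      (((summable_nat_add_iff k).2 hmsum.summable).hasSum).mul_right _
    have DS2 := HasSum.prod_fiberwise DS' hk
    refine hasSum_le (fun k => ?_) DS2 (geo_hasSum ha)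
    have : ∑' y, m (y + k) ≤ 1 := by
      have h1 := hmsum.summable.sum_add_tsum_nat_add k
      rw [hmsum.tsum_eq] at h1
      have : 0 ≤ ∑ i ∈ Finset.range k, m i := Finset.sum_nonneg fun i _ => (mpos i).le
      linarith
    have g0 := geo_pos ha k
    nlinarith
  -- integrability
  have I1 := MI_integrable μ hd H1
  have I2 := MI_integrable μ' hd H2
  have I2' := (integrable_map_measure I2.1 hφ.aemeasurable).1 I2
  have EM : poissonMI μ' a = ∫ u, (∑' z : ℕ, poissonPMFr (a * φ u) z *
      Real.log (poissonPMFr (a * φ u) z / m z)) ∂μ := by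
    unfold poissonMI
    rw [hμ', integral_map hφ.aemeasurable I2.1]
  have I2'' : Integrable (fun u => (∑' z : ℕ, poissonPMFr (a * φ u) z *
      Real.log (poissonPMFr (a * φ u) z / m z))) μ := I2'
  -- pointwise inequality
  have key : ∀ᵐ u ∂μ, (∑' z : ℕ, poissonPMFr (a * u) z *
      Real.log (poissonPMFr (a * u) z / mb z)) ≤ (∑' z : ℕ, poissonPMFr (a * φ u) z *
      Real.log (poissonPMFr (a * φ u) z / m z)) + Psi a + (∑' p : ℕ × ℕ,
        m (p.1 + p.2) * geo a p.2 / mb p.1 * poissonPMFr (a * u) p.1) - 1 := by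
    filter_upwards [H1, H2', hD, h] with u h1 h2 h3 h4
    have hu0 : 0 < u := by linarith
    have hφu := hφ1 u hu0
    have hx : 0 < a * u := by positivity
    obtain ⟨t, ht⟩ : ∃ t, t = a * (φ u - u) := ⟨_, rfl⟩
    have ht0 : 0 ≤ t := by rw [ht]; exact mul_nonneg ha.le (by linarith)
    have hta : t ≤ a := by rw [ht]; nlinarith
    have hxt : a * φ u = a * u + t := by rw [ht]; ring
    have lr1 : ∀ z : ℕ, |Real.log (poissonPMFr (a * u) z / mb z)| ≤ b + Real.log (b / d) * z :=
      fun z => logratio_bound hd h1.1 h1.2 (marg_bounds μ hd H1 z).1 (marg_bounds μ hd H1 z).2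
    have lr2 : ∀ z : ℕ, |Real.log (poissonPMFr (a * φ u) z / m z)| ≤ b + Real.log (b / d) * z :=
      fun z => logratio_bound hd h2.1 h2.2 (marg_bounds μ' hd H2 z).1 (marg_bounds μ' hd H2 z).2
    have s1 : Summable (fun z => poissonPMFr (a * u) z *
        Real.log (poissonPMFr (a * u) z / mb z)) := by
      refine Summable.of_norm_bounded (pois_summable_lin (a * u) b (Real.log (b / d))) fun z => ?_
      rw [norm_mul, Real.norm_eq_abs, Real.norm_eq_abs, abs_of_nonneg (pois_nonneg hx.le z)]
      exact mul_le_mul_of_nonneg_left (lr1 z) (pois_nonneg hx.le z)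
    have c1 := hasSum_prod_mul s1.hasSum (hasSum_pois t)
    have c2 := pois_double hx.le ht0 (fun z => Real.log (poissonPMFr (a * φ u) z / m z)) lr2
    have w1 : HasSum (fun k : ℕ => poissonPMFr t k * -Real.log (geo a k))
        (Real.log (1 + a) + Real.log ((1 + a) / a) * t) := by
      have := ((hasSum_pois t).mul_left (Real.log (1 + a))).add
        ((hasSum_pois_mul t).mul_left (Real.log ((1 + a) / a)))
      rw [mul_one] at this
      convert! this using 2 with k
      rw [log_geo ha]; ring
    have c3 := hasSum_prod_mul (hasSum_pois (a * u)) w1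
    have c4 := (Summable.of_norm_bounded (f := fun p : ℕ × ℕ =>
      m (p.1 + p.2) * geo a p.2 / mb p.1 * poissonPMFr (a * u) p.1) bsum h3).hasSum
    have c5 := hasSum_prod_mul (hasSum_pois (a * u)) (hasSum_pois t)
    have pw : ∀ p : ℕ × ℕ, poissonPMFr (a * u) p.1 * Real.log (poissonPMFr (a * u) p.1 / mb p.1)
          * poissonPMFr t p.2 ≤ poissonPMFr (a * u) p.1 * poissonPMFr t p.2
          * Real.log (poissonPMFr (a * φ u) (p.1 + p.2) / m (p.1 + p.2))
          + poissonPMFr (a * u) p.1 * (poissonPMFr t p.2 * -Real.log (geo a p.2))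
          + m (p.1 + p.2) * geo a p.2 / mb p.1 * poissonPMFr (a * u) p.1
          - poissonPMFr (a * u) p.1 * poissonPMFr t p.2 := by
      intro p
      refine pointwise_ineq (pois_pos hx _) (pois_nonneg ht0 _) (pois_pos ?_ _) (mbpos _) (mpos _)
        (geo_pos ha _) ?_
      · linarith [h2.1]
      · rw [hxt]; exact pois_mul_le hx.le ht0 _ _
    have fin := hasSum_le pw c1 (((c2.add c3).add c4).sub c5)
    have hPsi : Real.log (1 + a) + Real.log ((1 + a) / a) * t ≤ Psi a := by
      rw [Psi_eq ha]
      have : 0 ≤ Real.log ((1 + a) / a) :=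
        Real.log_nonneg (by rw [le_div_iff₀ ha]; linarith)
      rw [mul_comm a]
      exact add_le_add_right (mul_le_mul_of_nonneg_left hta this) _
    rw [← hxt] at fin
    linarith
  rw [EM]
  unfold poissonMI
  have fin := integral_mono_ae I1 (((I2''.add (integrable_const (Psi a))).add DI).sub
    (integrable_const (1 : ℝ))) key
  rw [integral_sub' ((I2''.add (integrable_const (Psi a))).add DI) (integrable_const (1 : ℝ)),
    integral_add' (I2''.add (integrable_const (Psi a))) DI,
    integral_add' I2'' (integrable_const (Psi a))] at fin
  simp only [integral_const, probReal_univ, one_smul] at fin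
  linarith

/-- Lemma 9 of the paper: rounding the truncated gamma input upward to an integer
loses at most `Ψ(r_n/g_n) + ε` of Poisson-channel mutual information, for `n` large.
Here `X̄ = X̃|_{S_n}` has law `(gammaHalf g_n)[|S_n]` and `X = ⌈X̄⌉` has the
pushforward law under `u ↦ ⌈u⌉₊`. -/
theorem rounding_MI_loss (g r : ℕ → ℝ) (c : ℝ) (hc0 : 0 < c) (hce : c < Real.exp 1)
    (hgpos : ∀ n, 0 < g n) (hginf : Tendsto g atTop atTop)
    (hcr : ∀ n, c * g n ≤ r n) (hre : ∀ n, r n ≤ Real.exp 1 * g n)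
    (ρ : ℝ) (hρ : ρ ∈ Set.Ioo (0 : ℝ) 1) (ε : ℝ) (hε : 0 < ε) :
    ∃ n₀ : ℕ, ∀ n ≥ n₀,
      poissonMI
          (Measure.map (fun u : ℝ => (⌈u⌉₊ : ℝ))
            ((gammaHalf (g n))[|Set.Icc ((g n) ^ (-(1 + 3 * ρ)) : ℝ) ((g n) ^ ((1 : ℝ) + ρ))]))
          (r n / g n)
        ≥ poissonMI
            ((gammaHalf (g n))[|Set.Icc ((g n) ^ (-(1 + 3 * ρ)) : ℝ) ((g n) ^ ((1 : ℝ) + ρ))])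
            (r n / g n)
          - Psi (r n / g n) - ε := by
  refine ⟨0, fun n _ => ?_⟩
  have hg := hgpos n
  have ha : 0 < r n / g n := div_pos (lt_of_lt_of_le (by positivity) (hcr n)) hg
  set S := Set.Icc ((g n) ^ (-(1 + 3 * ρ)) : ℝ) ((g n) ^ ((1 : ℝ) + ρ)) with hS
  have hP : IsProbabilityMeasure (gammaHalf (g n)) :=
    isProbabilityMeasure_gammaMeasure (by norm_num) (by positivity)
  by_cases h0 : gammaHalf (g n) S = 0
  · rw [cond_eq_zero_of_meas_eq_zero h0]
    have := Psi_nonneg ha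
    simp only [Measure.map_zero, poissonMI, integral_zero_measure]
    linarith
  · have := cond_isProbabilityMeasure h0
    have := abs_main ((gammaHalf (g n))[|S]) (a := r n / g n) (l := (g n) ^ (-(1 + 3 * ρ)))
      (R := (g n) ^ ((1 : ℝ) + ρ)) ha (Real.rpow_pos_of_pos hg _)
      (ae_cond_mem measurableSet_Icc) (fun u : ℝ => (⌈u⌉₊ : ℝ))
      (measurable_from_top.comp Nat.measurable_ceil)
      (fun u hu => ⟨Nat.le_ceil u, (Nat.ceil_lt_add_one hu.le).le⟩)
    linarith
end

section
/- Let A and B be ℕ-valued random variables defined on a common probability space with A ≤ B almost surely, E[B − A] < ∞, and with finite Shannon entropies H(A), H(B) and H(A,B). Then H(A) − H(B) ≤ Ψ( E[B − A] ). -/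
open Filter Set MeasureTheory

/-- Shannon entropy of an `ℕ`-valued random variable `A` on `(Ω, μ)`. -/
noncomputable def natEntropy {Ω : Type*} [MeasurableSpace Ω] (μ : Measure Ω)
    (A : Ω → ℕ) : ℝ :=
  ∑' k : ℕ, Real.negMulLog (μ (A ⁻¹' {k})).toReal

lemma hasSum_comp_integral {Ω ι : Type*} [MeasurableSpace Ω] [MeasurableSpace ι] [Countable ι]
    [MeasurableSingletonClass ι] (μ : Measure Ω) [IsFiniteMeasure μ] (X : Ω → ι)
    (hX : Measurable X) (f : ι → ℝ) (hf : Integrable (fun ω => f (X ω)) μ) :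
    HasSum (fun i => (μ (X ⁻¹' {i})).toReal * f i) (∫ ω, f (X ω) ∂μ) := by
  have hm : ∀ i, MeasurableSet (X ⁻¹' {i}) := fun i => hX (measurableSet_singleton i)
  have hU : (⋃ i, X ⁻¹' {i}) = Set.univ := by ext ω; simp
  have h := hasSum_integral_iUnion (μ := μ) (f := fun ω => f (X ω)) hm
    (by
      intro i j hij
      refine Set.disjoint_left.2 ?_
      intro ω h1 h2
      simp only [Set.mem_preimage, Set.mem_singleton_iff] at h1 h2
      exact hij (h1.symm.trans h2)) (by rw [hU]; exact hf.integrableOn)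
  rw [hU, Measure.restrict_univ] at h
  have hfun : (fun i => (μ (X ⁻¹' {i})).toReal * f i) =
      fun i => ∫ ω in X ⁻¹' {i}, f (X ω) ∂μ := by
    funext i
    rw [setIntegral_congr_fun (g := fun _ => f i) (hm i)
      (by intro ω hω; simp only [Set.mem_preimage, Set.mem_singleton_iff] at hω; simp [hω])]
    simp [Measure.real]
  rw [hfun]
  exact h

lemma hasSum_marg (p : ℕ × ℕ → ℝ) (P g : ℕ → ℝ) (hp : ∀ x, 0 ≤ p x) (hg : ∀ a, 0 ≤ g a)
    (hs : ∀ a, HasSum (fun b => p (a, b)) (P a)) (h : Summable (fun a => P a * g a)) :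
    HasSum (fun x : ℕ × ℕ => p x * g x.1) (∑' a, P a * g a) := by
  have h1 : ∀ a, HasSum (fun b => p (a, b) * g a) (P a * g a) := fun a => (hs a).mul_right _
  have hsum : Summable (fun x : ℕ × ℕ => p x * g x.1) := by
    refine (summable_prod_of_nonneg (fun x => mul_nonneg (hp x) (hg _))).2
      ⟨fun a => (h1 a).summable, ?_⟩
    simpa only [(h1 _).tsum_eq] using h
  have h2 := hsum.hasSum.prod_fiberwise h1
  rw [h2.tsum_eq]
  exact hsum.hasSum

lemma core_ineq (p P Q q : ℝ) (hp : 0 ≤ p) (hP : p ≤ P) (hQ : p ≤ Q) (hq : 0 < q) :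
    p * (-Real.log P) - p * (-Real.log Q) ≤ Q * q - p + p * (-Real.log q) := by
  rcases hp.eq_or_lt with rfl | h0
  · simp only [zero_mul, sub_zero, add_zero]
    positivity
  · have hQ0 : 0 < Q := h0.trans_le hQ
    have h1 : Real.log (Q * q / p) ≤ Q * q / p - 1 := Real.log_le_sub_one_of_pos (by positivity)
    rw [Real.log_div (by positivity) h0.ne', Real.log_mul hQ0.ne' hq.ne'] at h1
    have h2 : Real.log p ≤ Real.log P := Real.log_le_log h0 hP
    have h3 : p * (Real.log Q + Real.log q - Real.log P) ≤ p * (Q * q / p - 1) :=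
      mul_le_mul_of_nonneg_left (by linarith) hp
    have h4 : p * (Q * q / p - 1) = Q * q - p := by field_simp
    nlinarith

lemma geo_sum (r : ℝ) (b : ℕ) (hr : 0 < r) :
    ∑ a ∈ Finset.range (b + 1), (1 - r) * r ^ (b - a) ≤ 1 := by
  rw [← Finset.mul_sum, Finset.sum_flip (fun k => r ^ k), mul_neg_geom_sum]
  have : 0 < r ^ (b + 1) := by positivity
  linarith

set_option maxHeartbeats 2000000 in
/-- For `ℕ`-valued `A ≤ B` a.s. with integrable difference and finite entropies,
`H(A) - H(B) ≤ Ψ(E[B - A])`. -/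
theorem entropy_difference_bound {Ω : Type*} [MeasurableSpace Ω]
    (μ : Measure Ω) [IsProbabilityMeasure μ]
    (A B : Ω → ℕ) (hA : Measurable A) (hB : Measurable B)
    (hAB : ∀ᵐ ω ∂μ, A ω ≤ B ω)
    (hInt : Integrable (fun ω => (B ω : ℝ) - (A ω : ℝ)) μ)
    (hHA : Summable (fun k : ℕ => Real.negMulLog (μ (A ⁻¹' {k})).toReal))
    (hHB : Summable (fun k : ℕ => Real.negMulLog (μ (B ⁻¹' {k})).toReal))
    (hHAB : Summable (fun p : ℕ × ℕ =>
      Real.negMulLog (μ (A ⁻¹' {p.1} ∩ B ⁻¹' {p.2})).toReal)) :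
    natEntropy μ A - natEntropy μ B ≤ Psi (∫ ω, ((B ω : ℝ) - (A ω : ℝ)) ∂μ) := by
  set m : ℝ := ∫ ω, ((B ω : ℝ) - (A ω : ℝ)) ∂μ with hm
  have hnn : 0 ≤ᵐ[μ] fun ω => (B ω : ℝ) - (A ω : ℝ) := by
    filter_upwards [hAB] with ω h
    have : (A ω : ℝ) ≤ B ω := by exact_mod_cast h
    simpa using this
  have hm0 : 0 ≤ m := integral_nonneg_of_ae hnn
  rcases hm0.eq_or_lt with h0 | hpos
  · have hz := (integral_eq_zero_iff_of_nonneg_ae hnn hInt).1 (hm.symm.trans h0.symm)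
    have hE : ∀ k, μ (A ⁻¹' {k}) = μ (B ⁻¹' {k}) := by
      intro k
      refine measure_congr ?_
      filter_upwards [hz] with ω h
      have : (B ω : ℝ) = A ω := by simpa [sub_eq_zero] using h
      have h' : B ω = A ω := by exact_mod_cast this
      apply propext
      change A ω = k ↔ B ω = k
      rw [h']
    rw [← h0]
    simp [natEntropy, hE, Psi, binEnt]
  set p : ℕ × ℕ → ℝ := fun x => (μ (A ⁻¹' {x.1} ∩ B ⁻¹' {x.2})).toReal with hpdef
  set P : ℕ → ℝ := fun k => (μ (A ⁻¹' {k})).toReal with hP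
  set Q : ℕ → ℝ := fun k => (μ (B ⁻¹' {k})).toReal with hQ
  have hp : ∀ x, 0 ≤ p x := fun x => ENNReal.toReal_nonneg
  have hpP : ∀ x, p x ≤ P x.1 := fun x =>
    ENNReal.toReal_mono (measure_ne_top _ _) (measure_mono inter_subset_left)
  have hpQ : ∀ x, p x ≤ Q x.2 := fun x =>
    ENNReal.toReal_mono (measure_ne_top _ _) (measure_mono inter_subset_right)
  have hP1 : ∀ k, P k ≤ 1 := fun k => ENNReal.toReal_le_of_le_ofReal zero_le_one (by simpa using prob_le_one)
  have hQ1 : ∀ k, Q k ≤ 1 := fun k => ENNReal.toReal_le_of_le_ofReal zero_le_one (by simpa using prob_le_one)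
  have hP0 : ∀ k, 0 ≤ P k := fun k => ENNReal.toReal_nonneg
  have hQ0 : ∀ k, 0 ≤ Q k := fun k => ENNReal.toReal_nonneg
  have mA : ∀ k, MeasurableSet (A ⁻¹' {k}) := fun k => hA (measurableSet_singleton k)
  have mB : ∀ k, MeasurableSet (B ⁻¹' {k}) := fun k => hB (measurableSet_singleton k)
  have margA : ∀ a, HasSum (fun b => p (a, b)) (P a) := by
    intro a
    have := hasSum_comp_integral (μ.restrict (A ⁻¹' {a})) B hB (fun _ => 1) (integrable_const _)
    simpa [Measure.restrict_apply (mB _), Set.inter_comm, hpdef, hP, Measure.real] using this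
  have margB : ∀ b, HasSum (fun a => p (a, b)) (Q b) := by
    intro b
    have := hasSum_comp_integral (μ.restrict (B ⁻¹' {b})) A hA (fun _ => 1) (integrable_const _)
    simpa [Measure.restrict_apply (mA _), hpdef, hQ, Measure.real] using this
  have pre : ∀ x : ℕ × ℕ, (fun ω => (A ω, B ω)) ⁻¹' {x} = A ⁻¹' {x.1} ∩ B ⁻¹' {x.2} := by
    intro x; ext ω; simp [Prod.ext_iff]
  have sumE : HasSum (fun x : ℕ × ℕ => p x * ((x.2 : ℝ) - x.1)) m := by
    have := hasSum_comp_integral μ (fun ω => (A ω, B ω)) (hA.prodMk hB)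
      (fun x => (x.2 : ℝ) - x.1) hInt
    simpa only [pre] using this
  have sum1 : HasSum p 1 := by
    have := hasSum_comp_integral μ (fun ω => (A ω, B ω)) (hA.prodMk hB)
      (fun x => 1) (integrable_const _)
    simpa [pre] using this
  have sumQ : HasSum Q 1 := by
    have := hasSum_comp_integral μ B hB (fun x => 1) (integrable_const _)
    simpa using this
  have pzero : ∀ x : ℕ × ℕ, x.2 < x.1 → p x = 0 := by
    intro x hx
    have : μ (A ⁻¹' {x.1} ∩ B ⁻¹' {x.2}) = 0 := by
      refine measure_mono_null ?_ (ae_iff.1 hAB)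
      rintro ω ⟨h1, h2⟩
      simp only [Set.mem_preimage, Set.mem_singleton_iff] at h1 h2
      simp only [Set.mem_ofPred_eq]
      omega
    simp [hpdef, this]
  have SA : HasSum (fun x : ℕ × ℕ => p x * (-Real.log (P x.1))) (natEntropy μ A) := by
    have e : ∀ k, P k * (-Real.log (P k)) = Real.negMulLog (P k) := fun k => by
      simp [Real.negMulLog]
    have := hasSum_marg p P (fun k => -Real.log (P k)) hp
      (fun k => neg_nonneg.2 (Real.log_nonpos (hP0 k) (hP1 k))) margA (by simpa only [e] using hHA)
    simp only [e] at this
    exact this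
  have SB : HasSum (fun x : ℕ × ℕ => p x * (-Real.log (Q x.2))) (natEntropy μ B) := by
    have e : ∀ k, Q k * (-Real.log (Q k)) = Real.negMulLog (Q k) := fun k => by
      simp [Real.negMulLog]
    have := hasSum_marg (fun x => p x.swap) Q (fun k => -Real.log (Q k)) (fun x => hp _)
      (fun k => neg_nonneg.2 (Real.log_nonpos (hQ0 k) (hQ1 k))) margB (by simpa only [e] using hHB)
    simp only [e] at this
    exact (Equiv.prodComm ℕ ℕ).hasSum_iff.1 this
  set r : ℝ := m / (m + 1) with hr
  have hr0 : 0 < r := by positivity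
  have hr1 : r < 1 := by rw [hr, div_lt_one (by positivity)]; linarith
  have h1r : 0 < 1 - r := by linarith
  -- the comparison measure
  let G : ℕ × ℕ → ℝ := fun x => if x.2 ≤ x.1 then Q x.1 * ((1 - r) * r ^ (x.1 - x.2)) else 0
  have hG0 : ∀ x, 0 ≤ G x := by
    intro x
    by_cases h : x.2 ≤ x.1
    · simp only [G, h, if_true]
      have := hQ0 x.1
      positivity
    · simp [G, h]
  have hGin : ∀ b, HasSum (fun a => G (b, a))
      (Q b * ∑ a ∈ Finset.range (b + 1), (1 - r) * r ^ (b - a)) := by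
    intro b
    have h := hasSum_sum_of_ne_finset_zero (f := fun a => G (b, a)) (s := Finset.range (b + 1))
      (L := SummationFilter.unconditional ℕ)
      (by
        intro a ha
        have : ¬ a ≤ b := by simpa using ha
        simp [G, this])
    convert h using 1
    rw [Finset.mul_sum]
    refine Finset.sum_congr rfl ?_
    intro a ha
    have : a ≤ b := by simpa [Nat.lt_succ_iff] using ha
    simp [G, this]
  have hGle : ∀ b, Q b * ∑ a ∈ Finset.range (b + 1), (1 - r) * r ^ (b - a) ≤ Q b := fun b =>
    mul_le_of_le_one_right (hQ0 b) (geo_sum r b hr0)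
  have hGs : Summable G := by
    refine (summable_prod_of_nonneg hG0).2 ⟨fun b => (hGin b).summable, ?_⟩
    simp only [(hGin _).tsum_eq]
    refine Summable.of_nonneg_of_le (fun b => ?_) hGle sumQ.summable
    rw [← (hGin b).tsum_eq]
    exact tsum_nonneg fun a => hG0 _
  have hG1 : ∑' x, G x ≤ 1 := hasSum_le hGle (hGs.hasSum.prod_fiberwise hGin) sumQ
  have SG : HasSum (fun x : ℕ × ℕ => G x.swap) (∑' x, G x) :=
    (Equiv.prodComm ℕ ℕ).hasSum_iff.2 hGs.hasSum
  have key := hasSum_le (f := fun x : ℕ × ℕ => p x * (-Real.log (P x.1)) - p x * (-Real.log (Q x.2)))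
    (g := fun x : ℕ × ℕ => G x.swap - p x +
      (p x * (-Real.log (1 - r)) + p x * ((x.2 : ℝ) - x.1) * (-Real.log r))) ?_ (SA.sub SB)
    ((SG.sub sum1).add ((sum1.mul_right _).add (sumE.mul_right _)))
  · refine key.trans ?_
    have hPsi : Psi m = -Real.log (1 - r) + m * (-Real.log r) := by
      have e1 : 1 / (m + 1) = 1 - r := by rw [hr]; field_simp; ring
      have e2 : (m + 1) * (1 - r) = 1 := by rw [hr]; field_simp; ring
      have e3 : (m + 1) * r = m := by rw [hr]; field_simp
      rw [Psi, e1, binEnt, sub_sub_cancel]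
      linear_combination (-Real.log (1 - r)) * e2 - Real.log r * e3
    rw [hPsi]
    linarith
  · rintro ⟨a, b⟩
    by_cases h : a ≤ b
    · have hq : 0 < (1 - r) * r ^ (b - a) := by positivity
      have := core_ineq (p (a, b)) (P a) (Q b) _ (hp _) (hpP _) (hpQ _) hq
      rw [Real.log_mul h1r.ne' (by positivity), Real.log_pow, Nat.cast_sub h] at this
      simp only [G, Prod.swap_prod_mk, h, if_true]
      linarith
    · have := pzero (a, b) (by simpa using h)
      simp [G, this, h]
end

section
/- The map λ ↦ H(Poisson(λ)) := ∑_{z∈ℕ} −p_λ(z)·log p_λ(z), where p_λ(z) := e^{−λ}·λ^z/z!, is monotone nondecreasing on (0,∞); that is, for all 0 < λ₁ ≤ λ₂, H(Poisson(λ₁)) ≤ H(Poisson(λ₂)). -/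
open Filter Set

/-- The Shannon entropy (in nats) of the Poisson distribution with mean `lam`. -/
noncomputable def poissonEntropy (lam : ℝ) : ℝ :=
  ∑' z : ℕ, Real.negMulLog (poissonPMFr lam z)

lemma pois_hasSum (l : ℝ) : HasSum (poissonPMFr l) 1 := by
  have h := (NormedSpace.expSeries_div_hasSum_exp (𝔸 := ℝ) l).mul_left (Real.exp (-l))
  rw [← Real.exp_eq_exp_ℝ, ← Real.exp_add, neg_add_cancel, Real.exp_zero] at h
  have e : poissonPMFr l = fun z : ℕ => Real.exp (-l) * (l ^ z / (z.factorial : ℝ)) := by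
    funext z
    simp only [poissonPMFr]; ring
  rw [e]
  exact h

lemma pois_nonneg_s15 {l : ℝ} (hl : 0 ≤ l) (z : ℕ) : 0 ≤ poissonPMFr l z := by
  unfold poissonPMFr; positivity

lemma pois_le_one {l : ℝ} (hl : 0 ≤ l) (z : ℕ) : poissonPMFr l z ≤ 1 :=
  le_hasSum (pois_hasSum l) z (fun j _ => pois_nonneg_s15 hl j)

lemma pois_conv_s15 (a b : ℝ) (n : ℕ) :
    ∑ k ∈ Finset.range (n + 1), poissonPMFr a k * poissonPMFr b (n - k) = poissonPMFr (a + b) n := by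
  unfold poissonPMFr
  rw [add_pow, neg_add, Real.exp_add, Finset.mul_sum, Finset.sum_div]
  refine Finset.sum_congr rfl fun k hk => ?_
  have hk' : k ≤ n := Nat.lt_succ_iff.mp (Finset.mem_range.mp hk)
  rw [Nat.cast_choose ℝ hk']
  have h1 : (k.factorial : ℝ) ≠ 0 := by positivity
  have h2 : ((n - k).factorial : ℝ) ≠ 0 := by positivity
  have h3 : (n.factorial : ℝ) ≠ 0 := by positivity
  field_simp

lemma negMulLog_tangent {x y : ℝ} (hx : 0 ≤ x) (hy : 0 < y) :
    Real.negMulLog x ≤ -x * Real.log y + y - x := by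
  rcases hx.eq_or_lt with rfl | hx
  · simp [hy.le]
  have h := Real.log_le_sub_one_of_pos (div_pos hy hx)
  rw [Real.log_div hy.ne' hx.ne'] at h
  have := mul_le_mul_of_nonneg_left h hx.le
  have e : x * (y / x - 1) = y - x := by field_simp
  rw [e] at this
  unfold Real.negMulLog
  linarith

lemma pois_summable {l : ℝ} (hl : 0 < l) :
    Summable (fun z => Real.negMulLog (poissonPMFr l z)) := by
  have hs := ((Real.summable_pow_div_factorial (4 * l)).mul_left
    (Real.exp (-l) * (l + |Real.log l| + 1)))
  refine Summable.of_nonneg_of_le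
    (fun z => Real.negMulLog_nonneg (pois_nonneg_s15 hl.le z) (pois_le_one hl.le z)) (fun z => ?_) hs
  have hf : (0 : ℝ) < z.factorial := by positivity
  have hlog : -Real.log (poissonPMFr l z) = l - z * Real.log l + Real.log z.factorial := by
    unfold poissonPMFr
    rw [Real.log_div (by positivity) hf.ne', Real.log_mul (by positivity) (by positivity),
      Real.log_exp, Real.log_pow]
    ring
  have hz : (z : ℝ) ≤ 2 ^ z := by exact_mod_cast (Nat.lt_two_pow_self (n := z)).le
  have h4 : (4 : ℝ) ^ z = 2 ^ z * 2 ^ z := by rw [← mul_pow]; norm_num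
  have h2 : (1 : ℝ) ≤ 2 ^ z := one_le_pow₀ (by norm_num)
  have hz0 : (0 : ℝ) ≤ z := by positivity
  have hfac : Real.log z.factorial ≤ z * z := by
    rcases Nat.eq_zero_or_pos z with rfl | hzp
    · simp
    have hzp' : (0 : ℝ) < z := by exact_mod_cast hzp
    calc Real.log z.factorial ≤ Real.log ((z : ℝ) ^ z) :=
          Real.log_le_log hf (by exact_mod_cast Nat.factorial_le_pow z)
      _ = z * Real.log z := by rw [Real.log_pow]
      _ ≤ z * z := by
          have := Real.log_le_sub_one_of_pos hzp'
          gcongr; linarith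
  have hb : -Real.log (poissonPMFr l z) ≤ (l + |Real.log l| + 1) * 4 ^ z := by
    rw [hlog]
    have a1 : l ≤ l * 4 ^ z := le_mul_of_one_le_right hl.le (one_le_pow₀ (by norm_num))
    have a2 : -(z * Real.log l) ≤ |Real.log l| * 4 ^ z := by
      have : -(z * Real.log l) ≤ z * |Real.log l| := by nlinarith [neg_abs_le (Real.log l)]
      have h5 : (z : ℝ) ≤ 4 ^ z := by rw [h4]; nlinarith
      nlinarith [abs_nonneg (Real.log l)]
    have a3 : (z : ℝ) * z ≤ 4 ^ z := by rw [h4]; gcongr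
    linarith
  calc Real.negMulLog (poissonPMFr l z)
      = poissonPMFr l z * -Real.log (poissonPMFr l z) := by unfold Real.negMulLog; ring
    _ ≤ poissonPMFr l z * ((l + |Real.log l| + 1) * 4 ^ z) :=
        mul_le_mul_of_nonneg_left hb (pois_nonneg_s15 hl.le z)
    _ = _ := by unfold poissonPMFr; rw [mul_pow]; ring

/-- The Poisson entropy `λ ↦ H(Poi(λ))` is monotone nondecreasing on `(0,∞)`. -/
theorem poisson_entropy_monotone (l1 l2 : ℝ) (h1 : 0 < l1) (h12 : l1 ≤ l2) :
    poissonEntropy l1 ≤ poissonEntropy l2 := by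
  obtain ⟨d, rfl⟩ : ∃ d, l2 = d + l1 := ⟨l2 - l1, by ring⟩
  have hd : 0 ≤ d := by linarith
  have hpos : 0 < d + l1 := by linarith
  have hq := pois_hasSum d
  have hs := pois_summable h1
  have hqn := hq.summable.norm
  have hsn := hs.norm
  have key := tsum_mul_tsum_eq_tsum_sum_range_of_summable_norm hqn hsn
  have hsc := (summable_norm_sum_mul_range_of_summable_norm hqn hsn).of_norm
  rw [hq.tsum_eq, one_mul] at key
  unfold poissonEntropy
  rw [key]
  refine hsc.tsum_le_tsum (fun n => ?_) (pois_summable hpos)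
  set y := poissonPMFr (d + l1) n with hy
  have hy0 : 0 < y := by rw [hy]; unfold poissonPMFr; positivity
  have hc := pois_conv_s15 d l1 n
  have hq1 : ∑ k ∈ Finset.range (n + 1), poissonPMFr d k ≤ 1 :=
    sum_le_hasSum _ (fun k _ => pois_nonneg_s15 hd k) hq
  calc ∑ k ∈ Finset.range (n + 1), poissonPMFr d k * Real.negMulLog (poissonPMFr l1 (n - k))
      ≤ ∑ k ∈ Finset.range (n + 1), poissonPMFr d k *
          (-poissonPMFr l1 (n - k) * Real.log y + y - poissonPMFr l1 (n - k)) :=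
        Finset.sum_le_sum fun k _ => mul_le_mul_of_nonneg_left
          (negMulLog_tangent (pois_nonneg_s15 h1.le _) hy0) (pois_nonneg_s15 hd k)
    _ = ∑ k ∈ Finset.range (n + 1), ((poissonPMFr d k * poissonPMFr l1 (n - k)) *
          (-Real.log y - 1) + poissonPMFr d k * y) :=
        Finset.sum_congr rfl fun k _ => by ring
    _ = y * (-Real.log y - 1) + (∑ k ∈ Finset.range (n + 1), poissonPMFr d k) * y := by
        rw [Finset.sum_add_distrib, ← Finset.sum_mul, ← Finset.sum_mul, hc]
    _ ≤ Real.negMulLog y := by unfold Real.negMulLog; nlinarith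
end

section
/- If V ~ Poisson(λ) with λ > 0, then E[ V·log V ] ≤ λ·log(1+λ), where the function v ↦ v·log v is extended by 0·log 0 := 0. -/
open Filter Set

theorem poissonPMFr_hasSum (lam : ℝ) : HasSum (poissonPMFr lam) 1 := by
  have h : HasSum (fun n : ℕ => lam ^ n / (n.factorial : ℝ)) (Real.exp lam) := by
    rw [Real.exp_eq_exp_ℝ]
    exact NormedSpace.expSeries_div_hasSum_exp lam
  have h2 := h.mul_left (Real.exp (-lam))
  rw [← Real.exp_add, neg_add_cancel, Real.exp_zero] at h2
  have he : poissonPMFr lam =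
      fun i : ℕ => Real.exp (-lam) * (lam ^ i / (i.factorial : ℝ)) := by
    funext z
    simp only [poissonPMFr]
    ring
  rw [he]
  exact h2

theorem poissonPMFr_succ (lam : ℝ) (z : ℕ) :
    poissonPMFr lam (z + 1) * ((z + 1 : ℕ) : ℝ) = lam * poissonPMFr lam z := by
  unfold poissonPMFr
  rw [Nat.factorial_succ]
  have h1 : ((z + 1 : ℕ) : ℝ) ≠ 0 := by positivity
  have h2 : (z.factorial : ℝ) ≠ 0 := by positivity
  push_cast at h1 ⊢
  field_simp
  ring

theorem poissonPMFr_hasSum_mean (lam : ℝ) :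
    HasSum (fun z : ℕ => poissonPMFr lam z * (z : ℝ)) lam := by
  rw [← hasSum_nat_add_iff' 1]
  simp only [poissonPMFr_succ]
  simpa using (poissonPMFr_hasSum lam).mul_left lam

theorem poissonPMFr_hasSum_sq (lam : ℝ) :
    HasSum (fun z : ℕ => poissonPMFr lam z * (z : ℝ) * (z : ℝ)) (lam * (lam + 1)) := by
  rw [← hasSum_nat_add_iff' 1]
  simp only [poissonPMFr_succ]
  have h := ((poissonPMFr_hasSum_mean lam).add (poissonPMFr_hasSum lam)).mul_left lam
  simp only [Finset.range_one, Finset.sum_singleton, Nat.cast_zero, mul_zero, sub_zero]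
  have he : (fun z : ℕ => lam * poissonPMFr lam z * ((z + 1 : ℕ) : ℝ)) =
      fun z : ℕ => lam * (poissonPMFr lam z * (z : ℝ) + poissonPMFr lam z) := by
    funext z
    push_cast
    ring
  rw [he]
  exact h

/-- For `V ~ Poi(λ)`, `E[V log V] ≤ λ log(1+λ)` (with `0 log 0 = 0`). -/
theorem poisson_vlogv_bound (lam : ℝ) (hlam : 0 < lam) :
    (∑' z : ℕ, poissonPMFr lam z * ((z : ℝ) * Real.log z)) ≤ lam * Real.log (1 + lam) := by
  have hc : 0 < 1 + lam := by linarith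
  have hp : ∀ z, 0 ≤ poissonPMFr lam z := fun z => by unfold poissonPMFr; positivity
  have hs := ((poissonPMFr_hasSum_mean lam).mul_right (Real.log (1 + lam) - 1)).add
    ((poissonPMFr_hasSum_sq lam).mul_right (1 + lam)⁻¹)
  have hle : ∀ z : ℕ, poissonPMFr lam z * ((z : ℝ) * Real.log z) ≤
      poissonPMFr lam z * (z : ℝ) * (Real.log (1 + lam) - 1) +
        poissonPMFr lam z * (z : ℝ) * (z : ℝ) * (1 + lam)⁻¹ := by
    intro z
    rcases Nat.eq_zero_or_pos z with rfl | hz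
    · simp
    have hz' : (0 : ℝ) < z := by exact_mod_cast hz
    have h1 := Real.log_le_sub_one_of_pos (div_pos hz' hc)
    rw [Real.log_div hz'.ne' hc.ne', div_eq_mul_inv] at h1
    have h2 := mul_le_mul_of_nonneg_left h1 (mul_nonneg (hp z) hz'.le)
    linarith
  have hsum : Summable (fun z : ℕ => poissonPMFr lam z * ((z : ℝ) * Real.log z)) :=
    Summable.of_nonneg_of_le
      (fun z => mul_nonneg (hp z) (mul_nonneg (Nat.cast_nonneg z) (Real.log_natCast_nonneg z)))
      hle hs.summable
  refine (hasSum_le hle hsum.hasSum hs).trans (le_of_eq ?_)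
  field_simp
  ring
end

section
/- Let V_1,…,V_n be independent random variables with V_i ~ Poisson(λ_i) for λ_i > 0, and let λ̄ ≥ max_{i∈[n]} λ_i. Let β > 0 and let f : ℕ^n → ℝ be integrable with respect to the law of V = (V_1,…,V_n) and satisfy | f(v + e_i) − f(v) | ≤ β for every v ∈ ℕ^n and every i ∈ [n], where e_i is the i-th standard unit vector. Then for every δ > 0, P[ f(V) − E[f(V)] > n·δ ] ≤ exp( − n·δ² / (16·β²·λ̄ + 3·β·δ) ). -/
open Filter Set

lemma hasSum_transfer {α : Type*} {f g : α → ℝ} {a b : ℝ} (h : HasSum f a)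
    (hf : ∀ x, g x = f x) (hb : b = a) : HasSum g b := by
  obtain rfl : g = f := funext hf
  rwa [hb]

lemma hasSum_mul_nonneg {α γ : Type*} {f : α → ℝ} {g : γ → ℝ} {a b : ℝ} (hf : HasSum f a)
    (hg : HasSum g b) (f0 : 0 ≤ f) (g0 : 0 ≤ g) :
    HasSum (fun x : α × γ => f x.1 * g x.2) (a * b) :=
  hf.mul hg (hf.summable.mul_of_nonneg hg.summable f0 g0)

lemma pois_pos_s19 {l : ℝ} (hl : 0 < l) (k : ℕ) : 0 < poissonPMFr l k := by
  unfold poissonPMFr; positivity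

/-- Exponential moments of the Poisson law. -/
lemma pois_mgf (l s : ℝ) :
    HasSum (fun k : ℕ => poissonPMFr l k * Real.exp (s * k)) (Real.exp (l * (Real.exp s - 1))) := by
  have h := NormedSpace.expSeries_div_hasSum_exp (l * Real.exp s)
  rw [← Real.exp_eq_exp_ℝ] at h
  have h2 := h.mul_left (Real.exp (-l))
  rw [← Real.exp_add] at h2
  refine hasSum_transfer h2 (fun k => ?_) ?_
  · unfold poissonPMFr
    rw [mul_pow, ← Real.exp_nat_mul, mul_comm s]
    ring
  · congr 1; ring

lemma pois_sum (l : ℝ) : HasSum (fun k : ℕ => poissonPMFr l k) 1 := by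
  simpa using pois_mgf l 0

lemma lip_nat {β : ℝ} (g : ℕ → ℝ) (hg : ∀ k, |g (k + 1) - g k| ≤ β) (k j : ℕ) :
    |g k - g j| ≤ β * |(k : ℝ) - j| := by
  have key : ∀ a d : ℕ, |g (a + d) - g a| ≤ β * d := by
    intro a d
    induction d with
    | zero => simp
    | succ d ih =>
      have h1 := hg (a + d)
      have h2 := abs_sub_le (g (a + d + 1)) (g (a + d)) (g a)
      push_cast
      rw [← add_assoc]
      linarith
  rcases le_total j k with h | h
  · obtain ⟨d, rfl⟩ := Nat.exists_eq_add_of_le h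
    simpa using key j d
  · obtain ⟨d, rfl⟩ := Nat.exists_eq_add_of_le h
    have := key k d
    rw [abs_sub_comm]
    simpa using this

lemma pois_exp_summable {l β : ℝ} (hl : 0 < l) (g : ℕ → ℝ)
    (hg : ∀ k, |g (k + 1) - g k| ≤ β) (t : ℝ) :
    Summable (fun k => poissonPMFr l k * Real.exp (t * g k)) := by
  have h := (pois_mgf l (|t| * β)).summable.mul_left (Real.exp (t * g 0))
  refine Summable.of_nonneg_of_le
    (fun k => mul_nonneg (pois_pos_s19 hl k).le (Real.exp_pos _).le) (fun k => ?_) h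
  have h1 := lip_nat g hg k 0
  have h2 : t * (g k - g 0) ≤ |t| * β * k := by
    calc t * (g k - g 0) ≤ |t * (g k - g 0)| := le_abs_self _
      _ = |t| * |g k - g 0| := abs_mul _ _
      _ ≤ |t| * (β * |(k : ℝ) - (0 : ℕ)|) := by gcongr
      _ = |t| * β * k := by simp [mul_assoc]
  calc poissonPMFr l k * Real.exp (t * g k)
      ≤ poissonPMFr l k * Real.exp (t * g 0 + |t| * β * k) := by
        have := pois_pos_s19 hl k
        gcongr
        linarith
    _ = _ := by rw [Real.exp_add]; ring

/-- One-dimensional bound on the log-moment generating function, by symmetrization. -/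
lemma one_dim {l β : ℝ} (hl : 0 < l) (g : ℕ → ℝ)
    (hg : ∀ k, |g (k + 1) - g k| ≤ β) (t m : ℝ)
    (hm : HasSum (fun k => poissonPMFr l k * g k) m) :
    Summable (fun k => poissonPMFr l k * Real.exp (t * (g k - m))) ∧
    ∑' k, poissonPMFr l k * Real.exp (t * (g k - m))
      ≤ Real.exp (2 * l * (Real.cosh (t * β) - 1)) := by
  have hg' : ∀ k, |(g (k + 1) - m) - (g k - m)| ≤ β := by
    intro k; simpa using hg k
  have sA := pois_exp_summable hl (fun k => g k - m) hg' t
  have sB := pois_exp_summable hl (fun k => g k - m) hg' (-t)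
  refine ⟨sA, ?_⟩
  set a : ℕ → ℝ := fun k => poissonPMFr l k * Real.exp (t * (g k - m)) with ha
  set b : ℕ → ℝ := fun k => poissonPMFr l k * Real.exp (-t * (g k - m)) with hb
  have ha0 : ∀ k, 0 ≤ a k := fun k => mul_nonneg (pois_pos_s19 hl k).le (Real.exp_pos _).le
  have hb0 : ∀ k, 0 ≤ b k := fun k => mul_nonneg (pois_pos_s19 hl k).le (Real.exp_pos _).le
  have hB : 1 ≤ ∑' k, b k := by
    have h1 : HasSum (fun k => poissonPMFr l k * (1 + -t * (g k - m))) 1 := by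
      have h3 := ((pois_sum l).mul_left (1 + t * m)).add (hm.mul_left (-t))
      refine hasSum_transfer h3 (fun k => ?_) ?_
      · ring
      · ring
    refine hasSum_le (fun k => ?_) h1 sB.hasSum
    have := pois_pos_s19 hl k
    simp only [hb]
    gcongr
    linarith [Real.add_one_le_exp (-t * (g k - m))]
  have hA0 : 0 ≤ ∑' k, a k := tsum_nonneg ha0
  -- product
  have sAB : HasSum (fun x : ℕ × ℕ => a x.1 * b x.2) ((∑' k, a k) * ∑' k, b k) :=
    sA.hasSum.mul sB.hasSum (sA.mul_of_nonneg sB ha0 hb0)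
  have sBA : HasSum (fun x : ℕ × ℕ => b x.1 * a x.2) ((∑' k, b k) * ∑' k, a k) :=
    sB.hasSum.mul sA.hasSum (sB.mul_of_nonneg sA hb0 ha0)
  have c1 := pois_mgf l (t * β)
  have c2 := pois_mgf l (-(t * β))
  have p1 : ∀ s : ℝ, 0 ≤ (fun k : ℕ => poissonPMFr l k * Real.exp (s * k)) :=
    fun s k => mul_nonneg (pois_pos_s19 hl k).le (Real.exp_pos _).le
  have sC := c1.mul c2 (c1.summable.mul_of_nonneg c2.summable (p1 _) (p1 _))
  have sD := c2.mul c1 (c2.summable.mul_of_nonneg c1.summable (p1 _) (p1 _))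
  have hle := hasSum_le (fun x => ?_) (sAB.add sBA) (sC.add sD)
  · have e1 : Real.exp (l * (Real.exp (t * β) - 1)) * Real.exp (l * (Real.exp (-(t * β)) - 1))
        = Real.exp (2 * l * (Real.cosh (t * β) - 1)) := by
      rw [← Real.exp_add, Real.cosh_eq]; congr 1; ring
    have e2 : Real.exp (l * (Real.exp (-(t * β)) - 1)) * Real.exp (l * (Real.exp (t * β) - 1))
        = Real.exp (2 * l * (Real.cosh (t * β) - 1)) := by rw [mul_comm, e1]
    rw [e1, e2] at hle
    nlinarith
  · obtain ⟨k, j⟩ := x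
    have hc : Real.cosh (t * (g k - g j)) ≤ Real.cosh (t * β * (k - j)) := by
      rw [Real.cosh_le_cosh, abs_mul, abs_mul, abs_mul, mul_assoc]
      gcongr
      refine (lip_nat g hg k j).trans ?_
      gcongr
      exact le_abs_self _
    rw [Real.cosh_eq, Real.cosh_eq] at hc
    have q1 : a k * b j + b k * a j = poissonPMFr l k * poissonPMFr l j *
        (Real.exp (t * (g k - g j)) + Real.exp (-(t * (g k - g j)))) := by
      simp only [ha, hb]
      have u1 : Real.exp (t * (g k - g j))
          = Real.exp (t * (g k - m)) * Real.exp (-t * (g j - m)) := by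
        rw [← Real.exp_add]; congr 1; ring
      have u2 : Real.exp (-(t * (g k - g j)))
          = Real.exp (-t * (g k - m)) * Real.exp (t * (g j - m)) := by
        rw [← Real.exp_add]; congr 1; ring
      rw [u1, u2]; ring
    have q2 : poissonPMFr l k * Real.exp (t * β * k) *
          (poissonPMFr l j * Real.exp (-(t * β) * j))
        + poissonPMFr l k * Real.exp (-(t * β) * k) *
          (poissonPMFr l j * Real.exp (t * β * j)) = poissonPMFr l k * poissonPMFr l j *
        (Real.exp (t * β * (k - j)) + Real.exp (-(t * β * (k - j)))) := by
      have u1 : Real.exp (t * β * (k - j))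
          = Real.exp (t * β * k) * Real.exp (-(t * β) * j) := by
        rw [← Real.exp_add]; congr 1; ring
      have u2 : Real.exp (-(t * β * (k - j)))
          = Real.exp (-(t * β) * k) * Real.exp (t * β * j) := by
        rw [← Real.exp_add]; congr 1; ring
      rw [u1, u2]; ring
    change a k * b j + b k * a j ≤ poissonPMFr l k * Real.exp (t * β * k) *
          (poissonPMFr l j * Real.exp (-(t * β) * j))
        + poissonPMFr l k * Real.exp (-(t * β) * k) *
          (poissonPMFr l j * Real.exp (t * β * j))
    rw [q1, q2]
    exact mul_le_mul_of_nonneg_left (by linarith)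
      (mul_pos (pois_pos_s19 hl k) (pois_pos_s19 hl j)).le

lemma prod_pos' {n : ℕ} {lam : Fin n → ℝ} (hlam : ∀ i, 0 < lam i) (v : Fin n → ℕ) :
    0 < ∏ i, poissonPMFr (lam i) (v i) :=
  Finset.prod_pos fun i _ => pois_pos_s19 (hlam i) _

lemma hasSum_cons {n : ℕ} (F : (Fin (n + 1) → ℕ) → ℝ) (m : ℝ) :
    HasSum (fun x : ℕ × (Fin n → ℕ) => F (Fin.cons x.1 x.2)) m ↔ HasSum F m :=
  (Fin.consEquiv (fun _ : Fin (n + 1) => ℕ)).hasSum_iff (f := F)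

lemma prod_sum : ∀ (n : ℕ) (lam : Fin n → ℝ), (∀ i, 0 < lam i) →
    HasSum (fun v : Fin n → ℕ => ∏ i, poissonPMFr (lam i) (v i)) 1 := by
  intro n
  induction n with
  | zero =>
    intro lam _
    simp
  | succ n ih =>
    intro lam hlam
    rw [← hasSum_cons]
    simp only [Fin.prod_univ_succ, Fin.cons_zero, Fin.cons_succ]
    have h1 := pois_sum (lam 0)
    have h2 := ih (fun i => lam i.succ) (fun i => hlam _)
    have n1 : 0 ≤ (fun k : ℕ => poissonPMFr (lam 0) k) := fun k => (pois_pos_s19 (hlam 0) k).le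
    have n2 : 0 ≤ (fun w : Fin n → ℕ => ∏ i, poissonPMFr (lam i.succ) (w i)) :=
      fun w => (prod_pos' (lam := fun i : Fin n => lam i.succ) (fun i => hlam _) w).le
    have h3 := hasSum_mul_nonneg h1 h2 n1 n2
    exact hasSum_transfer h3 (fun _ => rfl) (one_mul _).symm

/-- The moment generating function bound in dimension `n`. -/
lemma n_dim {β : ℝ} (t : ℝ) : ∀ (n : ℕ) (lam : Fin n → ℝ), (∀ i, 0 < lam i) →
    ∀ (f : (Fin n → ℕ) → ℝ) (m : ℝ),
    HasSum (fun v => (∏ i, poissonPMFr (lam i) (v i)) * f v) m →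
    (∀ (v : Fin n → ℕ) (i : Fin n), |f (Function.update v i (v i + 1)) - f v| ≤ β) →
    Summable (fun v => (∏ i, poissonPMFr (lam i) (v i)) * Real.exp (t * (f v - m))) ∧
    ∑' v, (∏ i, poissonPMFr (lam i) (v i)) * Real.exp (t * (f v - m))
      ≤ Real.exp (∑ i, 2 * lam i * (Real.cosh (t * β) - 1)) := by
  intro n
  induction n with
  | zero =>
    intro lam _ f m hm _
    have h := hasSum_unique (fun v : Fin 0 → ℕ => (∏ i, poissonPMFr (lam i) (v i)) * f v)
    have e := hm.unique h
    have h' := hasSum_unique (fun v : Fin 0 → ℕ =>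
      (∏ i, poissonPMFr (lam i) (v i)) * Real.exp (t * (f v - m)))
    refine ⟨h'.summable, ?_⟩
    rw [h'.tsum_eq]
    simp at e
    simp [e]
  | succ n ih =>
    intro lam hlam f m hm hLip
    rw [← hasSum_cons] at hm
    simp only [Fin.prod_univ_succ, Fin.cons_zero, Fin.cons_succ] at hm
    set p : ℕ → ℝ := fun k => poissonPMFr (lam 0) k with hp
    set q : (Fin n → ℕ) → ℝ := fun w => ∏ i, poissonPMFr (lam i.succ) (w i) with hq
    have hp0 : ∀ k, 0 < p k := fun k => pois_pos_s19 (hlam 0) k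
    have hq0 : ∀ w, 0 < q w := fun w => prod_pos' (fun i => hlam _) w
    have hq1 : HasSum q 1 := prod_sum n (fun i => lam i.succ) (fun i => hlam _)
    have hfib : ∀ k, Summable (fun w => q w * f (Fin.cons k w)) := by
      intro k
      have := (hm.summable.prod_factor k).mul_left (p k)⁻¹
      refine this.congr fun w => ?_
      have := (hp0 k).ne'
      change (p k)⁻¹ * (p k * q w * f (Fin.cons k w)) = _
      field_simp
    set g : ℕ → ℝ := fun k => ∑' w, q w * f (Fin.cons k w) with hgdef
    have hgs : HasSum (fun k => p k * g k) m := by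
      refine hm.prod_fiberwise fun k => ?_
      have := (hfib k).hasSum.mul_left (p k)
      simpa [mul_assoc] using this
    have hgL : ∀ k, |g (k + 1) - g k| ≤ β := by
      intro k
      have h1 := (hfib (k + 1)).hasSum.sub (hfib k).hasSum
      have hb : ∀ w, |f (Fin.cons (k + 1) w) - f (Fin.cons k w)| ≤ β := by
        intro w
        have := hLip (Fin.cons k w) 0
        rwa [Fin.update_cons_zero, Fin.cons_zero] at this
      have h2 := hq1.mul_right β
      rw [one_mul] at h2
      rw [abs_le]
      constructor
      · refine hasSum_le (fun w => ?_) h2.neg h1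
        have := (abs_le.1 (hb w)).1
        have := hq0 w
        nlinarith
      · refine hasSum_le (fun w => ?_) h1 h2
        have := (abs_le.1 (hb w)).2
        have := hq0 w
        nlinarith
    have hind : ∀ k, _ := fun k => ih (fun i => lam i.succ) (fun i => hlam _)
      (fun w => f (Fin.cons k w)) (g k) (hfib k).hasSum (by
        intro w i
        have := hLip (Fin.cons k w) i.succ
        rwa [← Fin.cons_update, Fin.cons_succ] at this)
    obtain ⟨so, ho⟩ := one_dim (hlam 0) g hgL t m hgs
    set E := Real.exp (∑ i : Fin n, 2 * lam i.succ * (Real.cosh (t * β) - 1)) with hE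
    set G : ℕ × (Fin n → ℕ) → ℝ :=
      fun x => p x.1 * q x.2 * Real.exp (t * (f (Fin.cons x.1 x.2) - m)) with hG
    have hGe : ∀ k w, G (k, w) = p k * Real.exp (t * (g k - m)) *
        (q w * Real.exp (t * (f (Fin.cons k w) - g k))) := by
      intro k w
      have : Real.exp (t * (f (Fin.cons k w) - m)) =
          Real.exp (t * (g k - m)) * Real.exp (t * (f (Fin.cons k w) - g k)) := by
        rw [← Real.exp_add]; congr 1; ring
      simp only [hG, this]; ring
    have hG0 : 0 ≤ G := fun x =>
      mul_nonneg (mul_pos (hp0 _) (hq0 _)).le (Real.exp_pos _).le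
    have hGf : ∀ k, Summable (fun w => G (k, w)) := by
      intro k
      simp only [hGe]
      exact (hind k).1.mul_left _
    have hGt : ∀ k, ∑' w, G (k, w) ≤ p k * Real.exp (t * (g k - m)) * E := by
      intro k
      simp only [hGe]
      rw [tsum_mul_left]
      exact mul_le_mul_of_nonneg_left (hind k).2
        (mul_nonneg (hp0 k).le (Real.exp_pos _).le)
    have hS : Summable (fun k => ∑' w, G (k, w)) :=
      Summable.of_nonneg_of_le (fun k => tsum_nonneg fun w => hG0 _) hGt (so.mul_right E)
    have hGs : Summable G := (summable_prod_of_nonneg hG0).2 ⟨hGf, hS⟩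
    have hGb : ∑' x, G x ≤ Real.exp (∑ i, 2 * lam i * (Real.cosh (t * β) - 1)) := by
      rw [hGs.tsum_prod' hGf, Fin.sum_univ_succ, Real.exp_add]
      refine (hS.tsum_le_tsum hGt (so.mul_right E)).trans ?_
      rw [tsum_mul_right]
      exact mul_le_mul_of_nonneg_right ho (Real.exp_pos _).le
    have hfin : HasSum (fun v : Fin (n + 1) → ℕ =>
        (∏ i, poissonPMFr (lam i) (v i)) * Real.exp (t * (f v - m))) (∑' x, G x) := by
      rw [← hasSum_cons]
      simp only [Fin.prod_univ_succ, Fin.cons_zero, Fin.cons_succ]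
      exact hGs.hasSum
    exact ⟨hfin.summable, hfin.tsum_eq.trans_le hGb⟩

lemma cosh_bound {s : ℝ} (h : s ^ 2 ≤ 1) : Real.cosh s - 1 ≤ s ^ 2 := by
  have h1 := Real.cosh_le_exp_half_sq s
  have h2 := Real.exp_bound_div_one_sub_of_interval (x := s ^ 2 / 2) (by positivity) (by linarith)
  have h3 : 1 / (1 - s ^ 2 / 2) ≤ 1 + s ^ 2 := by
    rw [div_le_iff₀ (by linarith)]
    nlinarith [sq_nonneg s]
  linarith

/-- Bobkov–Ledoux-type concentration of Lipschitz functions of independent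
Poisson random variables `V_i ~ Poi(λ_i)`:
`P[f(V) - E[f(V)] > nδ] ≤ exp(-nδ²/(16β²λ̄ + 3βδ))`. -/
theorem poisson_lipschitz_concentration (n : ℕ) (lam : Fin n → ℝ)
    (hlam : ∀ i, 0 < lam i) (lbar : ℝ) (hlbar : ∀ i, lam i ≤ lbar)
    (β : ℝ) (hβ : 0 < β) (f : (Fin n → ℕ) → ℝ)
    (hInt : Summable (fun v : Fin n → ℕ => (∏ i, poissonPMFr (lam i) (v i)) * |f v|))
    (hLip : ∀ (v : Fin n → ℕ) (i : Fin n),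
      |f (Function.update v i (v i + 1)) - f v| ≤ β)
    (δ : ℝ) (hδ : 0 < δ) :
    (∑' v : Fin n → ℕ,
        if (∑' w : Fin n → ℕ, (∏ i, poissonPMFr (lam i) (w i)) * f w) + n * δ < f v
        then ∏ i, poissonPMFr (lam i) (v i) else 0)
      ≤ Real.exp (-(n : ℝ) * δ ^ 2 / (16 * β ^ 2 * lbar + 3 * β * δ)) := by

  rcases Nat.eq_zero_or_pos n with rfl | hn
  · have hm := hasSum_unique (fun v : Fin 0 → ℕ => (∏ i, poissonPMFr (lam i) (v i)) * f v)
    rw [hm.tsum_eq]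
    have : ∀ v : Fin 0 → ℕ, f v = f default := fun v => by rw [Subsingleton.elim v default]
    simp [this]
  have hl0 : 0 < lbar := (hlam ⟨0, hn⟩).trans_le (hlbar _)
  set m := ∑' w : Fin n → ℕ, (∏ i, poissonPMFr (lam i) (w i)) * f w with hmdef
  have hm : HasSum (fun v : Fin n → ℕ => (∏ i, poissonPMFr (lam i) (v i)) * f v) m := by
    refine Summable.hasSum (Summable.of_norm ?_)
    refine hInt.congr fun v => ?_
    rw [norm_mul, Real.norm_eq_abs, Real.norm_eq_abs, abs_of_pos (prod_pos' hlam v)]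
  set D := 16 * β ^ 2 * lbar + 3 * β * δ with hD
  have hD0 : 0 < D := by positivity
  set t := 2 * δ / D with ht
  have ht0 : 0 < t := by positivity
  obtain ⟨hs, hb⟩ := n_dim t n lam hlam f m hm hLip
  have hle : ∀ v : Fin n → ℕ, (if m + n * δ < f v then ∏ i, poissonPMFr (lam i) (v i) else 0)
      ≤ Real.exp (-(t * (n * δ))) *
        ((∏ i, poissonPMFr (lam i) (v i)) * Real.exp (t * (f v - m))) := by
    intro v
    have hv := prod_pos' hlam v
    split_ifs with h
    · have : 1 ≤ Real.exp (-(t * (n * δ))) * Real.exp (t * (f v - m)) := by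
        rw [← Real.exp_add]
        apply Real.one_le_exp
        have : 0 ≤ t * (f v - m - n * δ) := mul_nonneg ht0.le (by linarith)
        linarith
      nlinarith
    · positivity
  have hs' := hs.mul_left (Real.exp (-(t * (n * δ))))
  have hsl := Summable.of_nonneg_of_le (fun v => by
    have := prod_pos' hlam v
    split_ifs
    · exact this.le
    · exact le_rfl) hle hs'
  refine (hsl.tsum_le_tsum hle hs').trans ?_
  rw [tsum_mul_left]
  refine (mul_le_mul_of_nonneg_left hb (Real.exp_pos _).le).trans ?_
  rw [← Real.exp_add, Real.exp_le_exp]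
  have htD : t * D = 2 * δ := by rw [ht]; field_simp
  have hsq : t * β ≤ 1 := by
    have : 3 * (t * β) * δ ≤ 2 * δ := by
      have : 0 ≤ t * (16 * β ^ 2 * lbar) := by positivity
      rw [hD] at htD
      nlinarith
    have := le_of_mul_le_mul_right this hδ
    linarith
  have hc := cosh_bound (s := t * β) (pow_le_one₀ (by positivity) hsq)
  have hc0 : 0 ≤ Real.cosh (t * β) - 1 := by linarith [Real.one_le_cosh (t * β)]
  have hsum : ∑ i, 2 * lam i * (Real.cosh (t * β) - 1) ≤ n * (2 * lbar * (t * β) ^ 2) := by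
    calc _ ≤ ∑ i : Fin n, 2 * lbar * (t * β) ^ 2 := by
          refine Finset.sum_le_sum fun i _ => ?_
          have := hlbar i
          gcongr
      _ = _ := by simp
  have h8 : 2 * lbar * (t * β) ^ 2 ≤ t * δ / 2 := by
    have h1 : 16 * β ^ 2 * lbar * t ≤ 2 * δ := by
      have : 0 ≤ t * (3 * β * δ) := by positivity
      rw [hD] at htD
      nlinarith
    nlinarith [mul_le_mul_of_nonneg_right h1 ht0.le, mul_pos hδ ht0]
  have he : -(n : ℝ) * δ ^ 2 / D = -(n * (t * δ / 2)) := by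
    rw [ht]; field_simp
  rw [he]
  have hn0 : (0 : ℝ) ≤ n := Nat.cast_nonneg n
  nlinarith [mul_le_mul_of_nonneg_left h8 hn0]
end
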